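/- Let n_1, n_2, n_3 be positive integers with n = n_1 + n_2 + n_3, let ω = e^{2πi/3}, and let Λ = (λ_1,…,λ_n) assign λ_i = ω^{j−1} ∈ ℂ ≅ ℝ² to every index i in the j-th block (the first n_1 indices form block 1, the next n_2 block 2, the last n_3 block 3). Then Z(Λ) = {x ∈ ℝ^n : ∑_{i=1}^n λ_i x_i² = 0 and ∑_{i=1}^n x_i² = 1} is homeomorphic to the product of spheres S^{n_1 − 1} × S^{n_2 − 1} × S^{n_3 − 1}. -/

import Mathlib

open scoped BigOperators

/-- The real intersection of quadrics `Z(Λ) = {x ∈ ℝ^n : ∑ λᵢ xᵢ² = 0, ∑ xᵢ² = 1}` for a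
configuration `Λ` of complex numbers (identified with vectors in `ℝ²`). -/
def ZRealC {n : ℕ} (Λ : Fin n → ℂ) : Set (Fin n → ℝ) :=
  {x | (∑ i, Λ i * (((x i) ^ 2 : ℝ) : ℂ)) = 0 ∧ (∑ i, (x i) ^ 2) = 1}
/-- The configuration associated to the cyclic partition `n = n₁ + n₂ + n₃`: with
`ω = e^{2πi/3}`, each index in the `j`-th block is assigned `ω^{j-1}`. -/
noncomputable def triConfig (n₁ n₂ n₃ : ℕ) : Fin (n₁ + n₂ + n₃) → ℂ :=
  fun i =>
    if (i : ℕ) < n₁ then 1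
    else if (i : ℕ) < n₁ + n₂ then Complex.exp (2 * Real.pi * Complex.I / 3)
    else Complex.exp (2 * Real.pi * Complex.I / 3) ^ 2

/-- Real weights of total `1` balancing the three cube roots of unity are all `1 / 3`. -/
lemma cube_roots_balanced_iff (a b c : ℝ) :
    ((a : ℂ) + Complex.exp (2 * Real.pi * Complex.I / 3) * b
        + Complex.exp (2 * Real.pi * Complex.I / 3) ^ 2 * c = 0 ∧ a + b + c = 1) ↔
      a = 1 / 3 ∧ b = 1 / 3 ∧ c = 1 / 3 := by
  have hω : Complex.exp (2 * Real.pi * Complex.I / 3) = ⟨-(1 / 2), √3 / 2⟩ := by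
    have h : (2 * Real.pi * Complex.I / 3 : ℂ) = ((Real.pi - Real.pi / 3 : ℝ) : ℂ) * Complex.I := by
      push_cast; ring
    rw [h]
    apply Complex.ext
    · rw [Complex.exp_ofReal_mul_I_re, Real.cos_pi_sub, Real.cos_pi_div_three]
    · rw [Complex.exp_ofReal_mul_I_im, Real.sin_pi_sub, Real.sin_pi_div_three]
  have h3 : √3 * √3 = 3 := Real.mul_self_sqrt (by norm_num)
  have h0 : √3 ≠ 0 := by positivity
  rw [hω, Complex.ext_iff]
  simp only [pow_two, Complex.add_re, Complex.add_im, Complex.mul_re, Complex.mul_im,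
    Complex.ofReal_re, Complex.ofReal_im, Complex.zero_re, Complex.zero_im]
  constructor
  · rintro ⟨⟨hre, him⟩, hsum⟩
    have hbc : b = c := by
      apply mul_left_cancel₀ h0
      linarith
    have hre' : a - b / 2 - c / 2 = 0 := by linear_combination hre + c / 4 * h3
    refine ⟨?_, ?_, ?_⟩ <;> linarith
  · rintro ⟨rfl, rfl, rfl⟩
    refine ⟨⟨?_, by ring⟩, by norm_num⟩
    linear_combination -1 / 12 * h3

/-- Membership in the intersection of quadrics, expressed blockwise. -/
lemma mem_ZRealC_triConfig_iff {n₁ n₂ n₃ : ℕ} (x : Fin (n₁ + n₂ + n₃) → ℝ) :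
    x ∈ ZRealC (triConfig n₁ n₂ n₃) ↔
      ∑ i, x (Fin.castAdd n₃ (Fin.castAdd n₂ i)) ^ 2 = 1 / 3 ∧
      ∑ i, x (Fin.castAdd n₃ (Fin.natAdd n₁ i)) ^ 2 = 1 / 3 ∧
      ∑ i, x (Fin.natAdd (n₁ + n₂) i) ^ 2 = 1 / 3 := by
  rw [← cube_roots_balanced_iff]
  have hlt (i : Fin n₃) : ¬ n₁ + n₂ + (i : ℕ) < n₁ := by omega
  simp [ZRealC, triConfig, Fin.sum_univ_add, Finset.mul_sum, hlt]

lemma mem_unit_sphere_iff_sum_sq {n : ℕ} (v : EuclideanSpace ℝ (Fin n)) :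
    v ∈ Metric.sphere (0 : EuclideanSpace ℝ (Fin n)) 1 ↔ ∑ i, v i ^ 2 = 1 := by
  rw [mem_sphere_zero_iff_norm, EuclideanSpace.norm_eq, Real.sqrt_eq_one]
  simp

lemma sqrt_three_smul_mem_sphere {n : ℕ} {y : Fin n → ℝ} (hy : ∑ i, y i ^ 2 = 1 / 3) :
    WithLp.toLp 2 (fun i => √3 * y i) ∈ Metric.sphere (0 : EuclideanSpace ℝ (Fin n)) 1 := by
  rw [mem_unit_sphere_iff_sum_sq]
  simp [mul_pow, ← Finset.mul_sum, hy]

lemma sum_sq_div_sqrt_three {n : ℕ} (v : Metric.sphere (0 : EuclideanSpace ℝ (Fin n)) 1) :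
    ∑ i, (v.1 i / √3) ^ 2 = 1 / 3 := by
  have hv := (mem_unit_sphere_iff_sum_sq v.1).1 v.2
  simp [div_pow, ← Finset.sum_div, hv]

/-- Rescaling each block by `√3` identifies `Z(Λ)` with the product of three unit spheres. -/
noncomputable def ZRealCTriConfigHomeomorph (n₁ n₂ n₃ : ℕ) :
    ↥(ZRealC (triConfig n₁ n₂ n₃)) ≃ₜ
      (Metric.sphere (0 : EuclideanSpace ℝ (Fin n₁)) 1 ×
        Metric.sphere (0 : EuclideanSpace ℝ (Fin n₂)) 1 ×
        Metric.sphere (0 : EuclideanSpace ℝ (Fin n₃)) 1) where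
  toFun x :=
    (⟨_, sqrt_three_smul_mem_sphere ((mem_ZRealC_triConfig_iff x.1).1 x.2).1⟩,
      ⟨_, sqrt_three_smul_mem_sphere ((mem_ZRealC_triConfig_iff x.1).1 x.2).2.1⟩,
      ⟨_, sqrt_three_smul_mem_sphere ((mem_ZRealC_triConfig_iff x.1).1 x.2).2.2⟩)
  invFun p :=
    ⟨Fin.append (Fin.append (fun i => p.1.1 i / √3) (fun i => p.2.1.1 i / √3))
        (fun i => p.2.2.1 i / √3), by
      rw [mem_ZRealC_triConfig_iff]
      simp only [Fin.append_left, Fin.append_right, sum_sq_div_sqrt_three, and_self]⟩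
  left_inv x := by
    apply Subtype.ext
    funext i
    refine Fin.addCases (fun j => Fin.addCases (fun k => ?_) (fun k => ?_) j) (fun k => ?_) i <;>
      simp
  right_inv p := by
    obtain ⟨u, v, w⟩ := p
    refine Prod.ext (Subtype.ext ?_) (Prod.ext (Subtype.ext ?_) (Subtype.ext ?_)) <;>
      ext i <;> simp [mul_div_cancel₀]
  continuous_toFun := by
    have hcoord (i : Fin (n₁ + n₂ + n₃)) :
        Continuous fun x : ↥(ZRealC (triConfig n₁ n₂ n₃)) => x.1 i :=
      (continuous_apply i).comp continuous_subtype_val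
    refine Continuous.prodMk ?_ (Continuous.prodMk ?_ ?_) <;>
      exact Continuous.subtype_mk ((PiLp.continuous_toLp 2 _).comp
        (continuous_pi fun i => continuous_const.mul (hcoord _))) _
  continuous_invFun := by
    refine Continuous.subtype_mk (continuous_pi fun i => ?_) _
    refine Fin.addCases (fun j => Fin.addCases (fun k => ?_) (fun k => ?_) j) (fun k => ?_) i <;>
      simp only [Fin.append_left, Fin.append_right] <;> fun_prop

/-- Case `ℓ = 1` of the classification of intersections of two quadrics: for the cyclic
partition `n = n₁ + n₂ + n₃`, the variety `Z(Λ)` is homeomorphic to the triple product of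
spheres `S^{n₁−1} × S^{n₂−1} × S^{n₃−1}`. -/
theorem Z_triple_product_of_spheres {n₁ n₂ n₃ : ℕ}
    (h₁ : 0 < n₁) (h₂ : 0 < n₂) (h₃ : 0 < n₃) :
    Nonempty (↥(ZRealC (triConfig n₁ n₂ n₃)) ≃ₜ
      (Metric.sphere (0 : EuclideanSpace ℝ (Fin n₁)) 1 ×
        Metric.sphere (0 : EuclideanSpace ℝ (Fin n₂)) 1 ×
        Metric.sphere (0 : EuclideanSpace ℝ (Fin n₃)) 1)) := by
  exact ⟨ZRealCTriConfigHomeomorph n₁ n₂ n₃⟩
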